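/- The vector fields v1, v2, v3 on ℝ^7 defined in the context commute with N1: [v1, N1] = [v2, N1] = [v3, N1] = 0 as vector fields on ℝ^7. -/

import Mathlib

/- Coordinates on ℝ^7: (x, ℓ1, ℓ2, ℓ3, y1, y2, y3) as indices 0,…,6. -/

/-- Lie bracket of vector fields on ℝ^7: [X,Y](p) = DY(p)·X(p) − DX(p)·Y(p). -/
noncomputable def lieBracket (X Y : (Fin 7 → ℝ) → (Fin 7 → ℝ)) :
    (Fin 7 → ℝ) → (Fin 7 → ℝ) :=
  fun p => fderiv ℝ Y p (X p) - fderiv ℝ X p (Y p)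

noncomputable def N1 : (Fin 7 → ℝ) → (Fin 7 → ℝ) := fun p =>
  ![1, 0, 0, 0,
    -((-Real.sqrt 3 / 2) * p 0 + p 1 - 1),
    -(p 2 - 1),
    -((Real.sqrt 3 / 2) * p 0 + p 3 - 1)]

noncomputable def v1 : (Fin 7 → ℝ) → (Fin 7 → ℝ) := fun p =>
  ![0, 0, -p 3, p 2, 0,
    -((Real.sqrt 3 / 4) * (p 0) ^ 2 - p 0 + p 6),
    -(p 0 - p 5)]

noncomputable def v2 : (Fin 7 → ℝ) → (Fin 7 → ℝ) := fun p =>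
  ![0, p 3, 0, -p 1,
    (Real.sqrt 3 / 4) * (p 0) ^ 2 - p 0 + p 6,
    0,
    (Real.sqrt 3 / 4) * (p 0) ^ 2 + p 0 - p 4]

noncomputable def v3 : (Fin 7 → ℝ) → (Fin 7 → ℝ) := fun p =>
  ![0, -p 2, p 1, 0,
    p 0 - p 5,
    -((Real.sqrt 3 / 4) * (p 0) ^ 2 + p 0 - p 4),
    0]

/-- The derivative of a differentiable map into a product can be computed componentwise along
lines. -/
lemma fderiv_eq_of_hasDerivAt_line {ι κ : Type*} [Fintype ι] [Fintype κ]
    {Y : (ι → ℝ) → (κ → ℝ)} {p w : ι → ℝ} {d : κ → ℝ} (hY : DifferentiableAt ℝ Y p)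
    (h : ∀ i, HasDerivAt (fun t : ℝ => Y (p + t • w) i) (d i) 0) :
    fderiv ℝ Y p w = d :=
  hY.hasFDerivAt.hasLineDerivAt w |>.unique (hasDerivAt_pi.2 h)

/-- A real function that agrees with a quadratic polynomial has the linear coefficient as its
derivative at `0`. -/
lemma hasDerivAt_zero_of_eq_quadratic {f : ℝ → ℝ} {a b : ℝ} (c : ℝ)
    (h : ∀ t, f t = a + b * t + c * t ^ 2) : HasDerivAt f b 0 := by
  rw [funext h]
  simpa using (((hasDerivAt_id (0 : ℝ)).const_mul b).const_add a).fun_add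
    (((hasDerivAt_id (0 : ℝ)).pow 2).const_mul c)

lemma fderiv_N1_apply (p w : Fin 7 → ℝ) :
    fderiv ℝ N1 p w =
      ![0, 0, 0, 0, Real.sqrt 3 / 2 * w 0 - w 1, -w 2, -(Real.sqrt 3 / 2) * w 0 - w 3] := by
  have hd : Differentiable ℝ N1 := by
    refine differentiable_pi.2 fun i => ?_
    fin_cases i <;> simp [N1] <;> fun_prop
  refine fderiv_eq_of_hasDerivAt_line (hd p) fun i => ?_
  refine hasDerivAt_zero_of_eq_quadratic (a := N1 p i) 0 fun t => ?_
  fin_cases i <;> simp [N1] <;> ring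

lemma fderiv_v1_apply (p w : Fin 7 → ℝ) :
    fderiv ℝ v1 p w = ![0, 0, -w 3, w 2, 0,
      -(Real.sqrt 3 / 2 * p 0 * w 0 - w 0 + w 6), -(w 0 - w 5)] := by
  have hd : Differentiable ℝ v1 := by
    refine differentiable_pi.2 fun i => ?_
    fin_cases i <;> simp [v1] <;> fun_prop
  refine fderiv_eq_of_hasDerivAt_line (hd p) fun i => ?_
  refine hasDerivAt_zero_of_eq_quadratic (a := v1 p i)
    (![0, 0, 0, 0, 0, -(Real.sqrt 3 / 4 * w 0 ^ 2), 0] i) fun t => ?_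
  fin_cases i <;> simp [v1] <;> ring

lemma fderiv_v2_apply (p w : Fin 7 → ℝ) :
    fderiv ℝ v2 p w = ![0, w 3, 0, -w 1, Real.sqrt 3 / 2 * p 0 * w 0 - w 0 + w 6, 0,
      Real.sqrt 3 / 2 * p 0 * w 0 + w 0 - w 4] := by
  have hd : Differentiable ℝ v2 := by
    refine differentiable_pi.2 fun i => ?_
    fin_cases i <;> simp [v2] <;> fun_prop
  refine fderiv_eq_of_hasDerivAt_line (hd p) fun i => ?_
  refine hasDerivAt_zero_of_eq_quadratic (a := v2 p i)
    (![0, 0, 0, 0, Real.sqrt 3 / 4 * w 0 ^ 2, 0, Real.sqrt 3 / 4 * w 0 ^ 2] i) fun t => ?_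
  fin_cases i <;> simp [v2] <;> ring

lemma fderiv_v3_apply (p w : Fin 7 → ℝ) :
    fderiv ℝ v3 p w = ![0, -w 2, w 1, 0, w 0 - w 5,
      -(Real.sqrt 3 / 2 * p 0 * w 0 + w 0 - w 4), 0] := by
  have hd : Differentiable ℝ v3 := by
    refine differentiable_pi.2 fun i => ?_
    fin_cases i <;> simp [v3] <;> fun_prop
  refine fderiv_eq_of_hasDerivAt_line (hd p) fun i => ?_
  refine hasDerivAt_zero_of_eq_quadratic (a := v3 p i)
    (![0, 0, 0, 0, 0, -(Real.sqrt 3 / 4 * w 0 ^ 2), 0] i) fun t => ?_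
  fin_cases i <;> simp [v3] <;> ring

theorem stmt_8 :
    lieBracket v1 N1 = (fun _ => (0 : Fin 7 → ℝ)) ∧
    lieBracket v2 N1 = (fun _ => (0 : Fin 7 → ℝ)) ∧
    lieBracket v3 N1 = (fun _ => (0 : Fin 7 → ℝ)) := by
  refine ⟨?_, ?_, ?_⟩ <;> funext p i
  · rw [lieBracket, fderiv_N1_apply, fderiv_v1_apply]
    fin_cases i <;> simp [N1, v1]
  · rw [lieBracket, fderiv_N1_apply, fderiv_v2_apply]
    fin_cases i <;> simp [N1, v2]
    ring
  · rw [lieBracket, fderiv_N1_apply, fderiv_v3_apply]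
    fin_cases i <;> simp [N1, v3]
    ring
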